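/- arXiv:1305.6957 — 3 statements merged into one kernel-verified Lean document; each statement's English description precedes it below -/
import Mathlib

section
/- Let Ess denote the Zariski-open set of cubic forms F ∈ S_3 in three variables that essentially depend on three variables, and let W ⊆ Ess be the subset of those F for which V((F^⊥)_2) ⊆ P(S_1) is nonempty. Then W is Zariski closed in Ess. -/
open MvPolynomial

noncomputable section WaringSetup

variable {k : Type} [Field k] {n : ℕ}

/-- The linear form `∑ aᵢ xᵢ` with coefficient vector `a`. -/
def linForm (a : Fin n → k) : MvPolynomial (Fin n) k :=
  ∑ i, C (a i) * X i

/-- A subset of the space `S₁` of linear forms (identified with the space of coefficient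
vectors) is homogeneous Zariski closed if it is the common zero locus of a set of
homogeneous polynomial functions. -/
def HomZariskiClosed (V : Set (Fin n → k)) : Prop :=
  ∃ P : Set (MvPolynomial (Fin n) k),
    (∀ p ∈ P, ∃ e : ℕ, p.IsHomogeneous e) ∧
    V = {a | ∀ p ∈ P, eval a p = 0}

/-- `F` can be written as a polynomial in `m` linear forms. -/
def WritableIn (m : ℕ) (F : MvPolynomial (Fin n) k) : Prop :=
  ∃ y : Fin m → MvPolynomial (Fin n) k,
    (∀ j, (y j).IsHomogeneous 1) ∧ ∃ G : MvPolynomial (Fin m) k, F = aeval y G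

/-- `F` essentially depends on `n` variables: after any linear change of coordinates it
cannot be written using fewer than `n` variables. -/
def EssDep (F : MvPolynomial (Fin n) k) : Prop :=
  ∀ m : ℕ, m < n → ¬ WritableIn m F

/-- `OrkV d F V` is the minimal number `m` such that `F` is a sum of `m` `d`-th powers of
linear forms lying outside `V` (and `⊤` if there is no such presentation). -/
def OrkV (d : ℕ) (F : MvPolynomial (Fin n) k) (V : Set (Fin n → k)) : ℕ∞ :=
  sInf ((fun m : ℕ => (m : ℕ∞)) ''
    {m : ℕ | ∃ l : Fin m → (Fin n → k), (∀ i, l i ∉ V) ∧ F = ∑ i, linForm (l i) ^ d})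

/-- The open Waring rank of a form `F`: the supremum of `OrkV d F V` over all homogeneous
Zariski-closed proper subsets `V ⊊ S₁`. -/
def Ork (d : ℕ) (F : MvPolynomial (Fin n) k) : ℕ∞ :=
  ⨆ V : {V : Set (Fin n → k) // HomZariskiClosed V ∧ V ≠ Set.univ}, OrkV d F V.1

/-- The open Waring rank `Ork(n, d)`: the supremum of `Ork F` over all forms `F` of degree
`d` essentially depending on `n` variables. -/
def OrkND (k : Type) [Field k] (n d : ℕ) : ℕ∞ :=
  ⨆ F : {F : MvPolynomial (Fin n) k // F.IsHomogeneous d ∧ EssDep F}, Ork d F.1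

/-- Apply the constant-coefficient differential operator `D` (a polynomial, whose variable
`i` is read as `∂/∂xᵢ`) to the polynomial `F`. -/
def contract (D F : MvPolynomial (Fin n) k) : MvPolynomial (Fin n) k :=
  ∑ s ∈ D.support, D.coeff s •
    ((List.finRange n).foldr (fun i G => (fun H => pderiv i H)^[s i] G) F)

/-- Polynomial functions on the affine space of polynomials: the subalgebra of functions
generated by the coefficient functionals. -/
def PolyFun (n : ℕ) (k : Type) [Field k] : Subalgebra k (MvPolynomial (Fin n) k → k) :=
  Algebra.adjoin k (Set.range fun s : Fin n →₀ ℕ => fun F => coeff s F)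

end WaringSetup

noncomputable section Helpers


/-- degree `N` exponents -/
abbrev ExpN (N : ℕ) := ↥(Finset.finsuppAntidiag (Finset.univ : Finset (Fin 3)) N)

theorem expN_deg {N : ℕ} (s : ExpN N) : (s : Fin 3 →₀ ℕ).degree = N := by
  have := (Finset.mem_finsuppAntidiag.1 s.2).1
  rw [Finsupp.degree_eq_sum]; exact this

theorem expN_mem {N : ℕ} (s : Fin 3 →₀ ℕ) (h : s.degree = N) :
    s ∈ Finset.finsuppAntidiag (Finset.univ : Finset (Fin 3)) N := by
  rw [Finset.mem_finsuppAntidiag]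
  rw [Finsupp.degree_eq_sum] at h
  exact ⟨h, Finset.subset_univ _⟩

theorem sum_expN {k : Type} [Field k] {N : ℕ} (p : MvPolynomial (Fin 3) k)
    (hp : p.IsHomogeneous N) (b : Fin 3 → k) :
    ∑ s : ExpN N, (∏ i, b i ^ (s : Fin 3 →₀ ℕ) i) * coeff (s : Fin 3 →₀ ℕ) p = eval b p := by
  rw [eval_eq']
  rw [Finset.sum_coe_sort (Finset.finsuppAntidiag (Finset.univ : Finset (Fin 3)) N)
    (fun s => (∏ i, b i ^ s i) * coeff s p)]
  symm
  rw [Finset.sum_subset (s₂ := Finset.finsuppAntidiag (Finset.univ : Finset (Fin 3)) N)]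
  · exact Finset.sum_congr rfl fun _ _ => mul_comm _ _
  · intro s hs
    apply expN_mem
    by_contra h
    exact (mem_support_iff.1 hs) (hp.coeff_eq_zero h)
  · intro s _ hs
    rw [notMem_support_iff.1 hs, zero_mul]

theorem exists_det {k ι J : Type} [Field k] [Fintype ι] [DecidableEq ι] (v : J → ι → k)
    (h : Submodule.span k (Set.range v) = ⊤) :
    ∃ t : ι → J, (Matrix.of fun s i => v (t i) s).det ≠ 0 := by
  obtain ⟨κ, a, ha, hs, hl⟩ := exists_linearIndependent' k v
  let B := Module.Basis.mk hl (by rw [hs, h])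
  let e : ι ≃ κ := (Pi.basisFun k ι).indexEquiv B
  refine ⟨fun i => a (e i), ?_⟩
  have h2 : LinearIndependent k (fun i => v (a (e i))) := hl.comp e e.injective
  have h3 := (Matrix.linearIndependent_cols_iff_isUnit
    (A := (Matrix.of fun s i => v (a (e i)) s))).1 h2
  rw [Matrix.isUnit_iff_isUnit_det] at h3
  exact h3.ne_zero

/-- the coefficient projection -/
def projN (k : Type) [Field k] (N : ℕ) : MvPolynomial (Fin 3) k →ₗ[k] (ExpN N → k) :=
  LinearMap.pi fun s => lcoeff k (s : Fin 3 →₀ ℕ)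

theorem projN_apply {k : Type} [Field k] {N : ℕ} (p : MvPolynomial (Fin 3) k) (s : ExpN N) :
    projN k N p s = coeff (s : Fin 3 →₀ ℕ) p := rfl

theorem proj_ideal {k J : Type} [Field k] (N : ℕ) (q : J → MvPolynomial (Fin 3) k)
    (p : MvPolynomial (Fin 3) k) (hp : p ∈ Ideal.span (Set.range q)) :
    projN k N p ∈ Submodule.span k
      (Set.range fun t : (Fin 3 →₀ ℕ) × J => projN k N (monomial t.1 1 * q t.2)) := by
  suffices H : ∀ r : MvPolynomial (Fin 3) k, projN k N (r * p) ∈ Submodule.span k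
      (Set.range fun t : (Fin 3 →₀ ℕ) × J => projN k N (monomial t.1 1 * q t.2)) by
    simpa using H 1
  induction hp using Submodule.span_induction with
  | mem x hx =>
    obtain ⟨j, rfl⟩ := hx
    intro r
    induction r using MvPolynomial.induction_on' with
    | monomial u c =>
      have : (monomial u c : MvPolynomial (Fin 3) k) * q j = c • (monomial u 1 * q j) := by
        rw [← smul_mul_assoc, smul_monomial]; simp
      rw [this, map_smul]
      exact Submodule.smul_mem _ _ (Submodule.subset_span ⟨(u, j), rfl⟩)
    | add p₁ p₂ h1 h2 => rw [add_mul, map_add]; exact Submodule.add_mem _ h1 h2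
  | zero => intro r; simp
  | add x y _ _ hx hy => intro r; rw [mul_add, map_add]; exact Submodule.add_mem _ (hx r) (hy r)
  | smul a x _ hx => intro r; rw [smul_eq_mul, ← mul_assoc]; exact hx _

/-- Main theorem of elimination theory (fixed family of quadrics in the plane). -/
theorem elimination {k A J : Type} [Field k] [IsAlgClosed k] [CommRing A]
    (Q : J → MvPolynomial (Fin 3) A) (hQ : ∀ j, (Q j).IsHomogeneous 2) :
    ∃ P : Set A, ∀ φ : A →+* k,
      (∃ b : Fin 3 → k, b ≠ 0 ∧ ∀ j, eval b (map φ (Q j)) = 0) ↔ ∀ f ∈ P, φ f = 0 := by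
  refine ⟨{f | ∃ (N : ℕ) (t : ExpN N → (Fin 3 →₀ ℕ) × J),
    f = (Matrix.of fun (s i : ExpN N) =>
      coeff (s : Fin 3 →₀ ℕ) (monomial (t i).1 1 * Q (t i).2)).det}, fun φ => ?_⟩
  have hdet : ∀ (N : ℕ) (t : ExpN N → (Fin 3 →₀ ℕ) × J),
      φ (Matrix.of fun (s i : ExpN N) =>
        coeff (s : Fin 3 →₀ ℕ) (monomial (t i).1 1 * Q (t i).2)).det =
      (Matrix.of fun (s i : ExpN N) =>
        projN k N (monomial (t i).1 1 * map φ (Q (t i).2)) s).det := by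
    intro N t
    rw [RingHom.map_det]
    congr 1
    ext s i
    simp only [RingHom.mapMatrix_apply, Matrix.map_apply, Matrix.of_apply, projN_apply]
    rw [← coeff_map, map_mul, map_monomial, map_one]
  constructor
  · rintro ⟨b, hb, hz⟩ f ⟨N, t, rfl⟩
    rw [hdet, ← Matrix.exists_vecMul_eq_zero_iff]
    refine ⟨fun s => ∏ i, b i ^ (s : Fin 3 →₀ ℕ) i, ?_, ?_⟩
    · obtain ⟨i, hi⟩ := Function.ne_iff.1 hb
      intro h
      have := congrFun h ⟨Finsupp.single i N, expN_mem _ (by simp)⟩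
      simp only [Pi.zero_apply, Finset.prod_eq_zero_iff] at this
      obtain ⟨j, _, hj⟩ := this
      by_cases hij : i = j
      · subst hij; exact hi (pow_eq_zero_iff (n := N) (by
          by_contra h0
          have : N = 0 := by omega
          subst this; simp at hj) |>.1 (by simpa using hj))
      · simp [hij] at hj
    · ext i
      simp only [Matrix.vecMul, dotProduct, Matrix.of_apply, projN_apply, Pi.zero_apply]
      have hh : (monomial (t i).1 (1:k) * map φ (Q (t i).2)).IsHomogeneous
          ((t i).1.degree + 2) := (isHomogeneous_monomial _ rfl).mul ((hQ _).map φ)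
      by_cases hN : (t i).1.degree + 2 = N
      · rw [hN] at hh
        rw [sum_expN _ hh]
        simp [hz]
      · apply Finset.sum_eq_zero
        intro s _
        rw [hh.coeff_eq_zero (by rw [expN_deg]; exact Ne.symm hN), mul_zero]
  · intro hP
    by_contra hno
    push Not at hno
    set I := Ideal.span (Set.range fun j => map φ (Q j)) with hI
    have hrad : ∀ i, (X i : MvPolynomial (Fin 3) k) ∈ I.radical := by
      intro i
      rw [← vanishingIdeal_zeroLocus_eq_radical (K := k), mem_vanishingIdeal_iff]
      intro x hx
      rw [aeval_X]
      by_cases hx0 : x = 0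
      · simp [hx0]
      obtain ⟨j, hj⟩ := hno x hx0
      exact absurd (hx _ (Ideal.subset_span ⟨j, rfl⟩)) (by simpa [aeval_eq_eval] using hj)
    choose e he using hrad
    set N := e 0 + e 1 + e 2 with hN
    have hmon : ∀ s : ExpN N, (monomial (s : Fin 3 →₀ ℕ) 1 : MvPolynomial (Fin 3) k) ∈ I := by
      intro s
      have hd := expN_deg s
      rw [Finsupp.degree_eq_sum, Fin.sum_univ_three] at hd
      have : ∃ i, e i ≤ (s : Fin 3 →₀ ℕ) i := by
        by_contra hc
        push Not at hc
        have h0 := hc 0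
        have h1 := hc 1
        have h2 := hc 2
        omega
      obtain ⟨i, hi⟩ := this
      have hle : Finsupp.single i (e i) ≤ (s : Fin 3 →₀ ℕ) := by
        rwa [Finsupp.single_le_iff]
      rw [← tsub_add_cancel_of_le hle, ← one_mul (1 : k), ← monomial_mul,
        ← X_pow_eq_monomial]
      exact Ideal.mul_mem_left _ _ (he i)
    have hspan : Submodule.span k (Set.range fun t : (Fin 3 →₀ ℕ) × J =>
        projN k N (monomial t.1 1 * map φ (Q t.2))) = ⊤ := by
      rw [eq_top_iff, ← (Pi.basisFun k (ExpN N)).span_eq, Submodule.span_le]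
      rintro _ ⟨s, rfl⟩
      have h1 := proj_ideal N (fun j => map φ (Q j)) _ (hmon s)
      have h2 : Pi.basisFun k (ExpN N) s = projN k N (monomial (s : Fin 3 →₀ ℕ) 1) := by
        ext u
        rw [projN_apply, coeff_monomial, Pi.basisFun_apply, Pi.single_apply]
        simp only [Subtype.ext_iff]
        congr 1
        exact propext eq_comm
      rw [h2]; exact h1
    obtain ⟨t, ht⟩ := exists_det _ hspan
    apply ht
    rw [← hdet N t]
    exact hP _ ⟨N, t, rfl⟩

theorem pderiv_swap {k : Type} [Field k] {n : ℕ} (i j : Fin n) (F : MvPolynomial (Fin n) k) :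
    pderiv i (pderiv j F) = pderiv j (pderiv i F) := by
  have : ⁅(pderiv i : Derivation k (MvPolynomial (Fin n) k) (MvPolynomial (Fin n) k)),
      (pderiv j : Derivation k (MvPolynomial (Fin n) k) (MvPolynomial (Fin n) k))⁆ = 0 := by
    apply MvPolynomial.derivation_ext
    intro l
    simp [Derivation.commutator_apply, pderiv_X, Pi.single_apply, apply_ite]
  have h := congrArg (fun D => D F) this
  simpa [Derivation.commutator_apply, sub_eq_zero] using h

/-- third-order coefficients -/
def c3 {k : Type} [Field k] (F : MvPolynomial (Fin 3) k) (i j l : Fin 3) : k :=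
  coeff 0 (pderiv i (pderiv j (pderiv l F)))

theorem coeff_pderiv_mem {k : Type} [Field k] {f : MvPolynomial (Fin 3) k → MvPolynomial (Fin 3) k}
    (hf : ∀ s, (fun F => coeff s (f F)) ∈ PolyFun 3 k) (i : Fin 3) :
    ∀ s, (fun F => coeff s (pderiv i (f F))) ∈ PolyFun 3 k := by
  intro s
  simp only [coeff_pderiv]
  exact Subalgebra.mul_mem _ (hf _) (Subalgebra.algebraMap_mem (PolyFun 3 k) ((s i : k) + 1))

theorem c3_mem {k : Type} [Field k] (i j l : Fin 3) :
    (fun F : MvPolynomial (Fin 3) k => c3 F i j l) ∈ PolyFun 3 k := by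
  refine coeff_pderiv_mem (f := fun F => pderiv j (pderiv l F)) ?_ i 0
  refine coeff_pderiv_mem (f := fun F => pderiv l F) ?_ j
  refine coeff_pderiv_mem (f := fun F => F) ?_ l
  intro s
  exact Algebra.subset_adjoin ⟨s, rfl⟩

/-- the operator of `contract` on a monomial -/
def opm {k : Type} [Field k] (s : Fin 3 →₀ ℕ) (F : MvPolynomial (Fin 3) k) :
    MvPolynomial (Fin 3) k :=
  (List.finRange 3).foldr (fun i G => (fun H => pderiv i H)^[s i] G) F

theorem opm_eq {k : Type} [Field k] (s : Fin 3 →₀ ℕ) (F : MvPolynomial (Fin 3) k) :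
    opm s F = (fun H => pderiv 0 H)^[s 0] ((fun H => pderiv 1 H)^[s 1]
      ((fun H => pderiv 2 H)^[s 2] F)) := by
  simp only [opm, List.finRange_succ, List.finRange_zero, List.map_cons, List.map_nil,
    List.foldr_cons, List.foldr_nil]
  rfl

/-- linear version of `contract` -/
def contractL {k : Type} [Field k] (F : MvPolynomial (Fin 3) k) :
    MvPolynomial (Fin 3) k →ₗ[k] MvPolynomial (Fin 3) k :=
  (MvPolynomial.basisMonomials (Fin 3) k).constr k (fun s => opm s F)

theorem contractL_eq {k : Type} [Field k] (D F : MvPolynomial (Fin 3) k) :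
    contractL F D = contract D F := by
  unfold contractL contract
  rw [Module.Basis.constr_apply]
  rfl

theorem contractL_XX {k : Type} [Field k] (i j : Fin 3) (F : MvPolynomial (Fin 3) k) :
    contractL F (X i * X j) = pderiv i (pderiv j F) := by
  have h : (X i * X j : MvPolynomial (Fin 3) k) =
      MvPolynomial.basisMonomials (Fin 3) k (Finsupp.single i 1 + Finsupp.single j 1) := by
    rw [coe_basisMonomials]
    simp [X, monomial_mul]
  rw [h, contractL, Module.Basis.constr_basis]
  rw [opm_eq]
  fin_cases i <;> fin_cases j
  · simp
  · simp
  · simp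
  · simpa using pderiv_swap _ _ _
  · simp
  · simp
  · simpa using pderiv_swap _ _ _
  · simpa using pderiv_swap _ _ _
  · simp

theorem homog_const {k : Type} [Field k] {p : MvPolynomial (Fin 3) k} (hp : p.IsHomogeneous 0) :
    p = C (coeff 0 p) := by
  rw [← totalDegree_zero_iff_isHomogeneous, totalDegree_eq_zero_iff_eq_C] at hp
  exact hp

theorem homog_lin {k : Type} [Field k] {p : MvPolynomial (Fin 3) k} (hp : p.IsHomogeneous 1) :
    p = ∑ i, C (coeff 0 (pderiv i p)) * X i := by
  have h := hp.sum_X_mul_pderiv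
  rw [one_smul] at h
  conv_lhs => rw [← h]
  refine Finset.sum_congr rfl fun i _ => ?_
  rw [mul_comm, ← homog_const (hp.pderiv (i := i))]

theorem homog_quad {k : Type} [Field k] [CharZero k] {p : MvPolynomial (Fin 3) k}
    (hp : p.IsHomogeneous 2) :
    p = ∑ i, ∑ j, (coeff 0 (pderiv j (pderiv i p)) / 2) • (X i * X j) := by
  have h := hp.sum_X_mul_pderiv
  have h2 : p = C (1/2 : k) * (2 • p) := by
    rw [nsmul_eq_mul, ← mul_assoc]
    have : C (1/2 : k) * ((2 : ℕ) : MvPolynomial (Fin 3) k) = 1 := by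
      rw [← map_natCast (C : k →+* MvPolynomial (Fin 3) k), ← C_mul]; simp
    rw [this, one_mul]
  conv_lhs => rw [h2, ← h]
  rw [Finset.mul_sum]
  refine Finset.sum_congr rfl fun i _ => ?_
  conv_lhs => rw [homog_lin (hp.pderiv (i := i))]
  rw [Finset.mul_sum, Finset.mul_sum]
  refine Finset.sum_congr rfl fun j _ => ?_
  rw [smul_eq_C_mul, div_eq_mul_one_div (coeff 0 _), C_mul (a := coeff 0 _)]
  ring

theorem contract_zero_iff {k : Type} [Field k] {F : MvPolynomial (Fin 3) k}
    (hF : F.IsHomogeneous 3) (d : Fin 3 → Fin 3 → k) :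
    contract (∑ i, ∑ j, d i j • (X i * X j)) F = 0 ↔
      ∀ l, ∑ i, ∑ j, d i j * c3 F l i j = 0 := by
  rw [← contractL_eq]
  simp only [map_sum, map_smul, contractL_XX]
  have hh : (∑ i, ∑ j, d i j • pderiv i (pderiv j F)).IsHomogeneous 1 := by
    refine IsHomogeneous.sum _ _ _ fun i _ => IsHomogeneous.sum _ _ _ fun j _ => ?_
    rw [smul_eq_C_mul]
    exact ((hF.pderiv (i := j)).pderiv (i := i)).C_mul _
  have hc : ∀ l, coeff 0 (pderiv l (∑ i, ∑ j, d i j • pderiv i (pderiv j F))) =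
      ∑ i, ∑ j, d i j * c3 F l i j := by
    intro l
    simp only [map_sum, Derivation.map_smul, coeff_sum, coeff_smul, smul_eq_mul, c3]
  constructor
  · intro h l
    rw [← hc, h]; simp
  · intro h
    rw [homog_lin hh]
    simp only [hc, h]; simp

theorem derivative_line {k : Type} [Field k] (F : MvPolynomial (Fin 3) k) (x b : Fin 3 → k) :
    Polynomial.derivative (aeval (fun i => Polynomial.C (x i) + Polynomial.C (b i) * Polynomial.X) F)
     = aeval (fun i => Polynomial.C (x i) + Polynomial.C (b i) * Polynomial.X)
      (∑ i, C (b i) * pderiv i F) := by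
  induction F using MvPolynomial.induction_on with
  | C a => simp [Polynomial.algebraMap_eq]
  | add p q hp hq =>
    simp only [map_add, hp, hq, mul_add, Finset.sum_add_distrib]
  | mul_X p i hp =>
    have e : ∑ j, C (b j) * pderiv j (p * X i) =
        (∑ j, C (b j) * pderiv j p) * X i + p * C (b i) := by
      simp only [Derivation.leibniz, smul_eq_mul, mul_add, Finset.sum_add_distrib, pderiv_X,
        Pi.single_apply]
      simp only [mul_ite, mul_one, mul_zero, Finset.sum_ite_eq, Finset.mem_univ, if_true,
        Finset.sum_mul]
      rw [add_comm]
      congr 1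
      · exact Finset.sum_congr rfl fun j _ => by ring
      · ring
    rw [e, map_mul, Polynomial.derivative_mul, hp, map_add, map_mul, map_mul, aeval_X, aeval_C,
      Polynomial.algebraMap_eq]
    simp

theorem writable_of {k : Type} [Field k] [CharZero k] (F : MvPolynomial (Fin 3) k)
    (b : Fin 3 → k) (hb : b ≠ 0) (h : ∑ i, C (b i) * pderiv i F = 0) : WritableIn 2 F := by
  obtain ⟨i, hi⟩ := Function.ne_iff.1 hb
  simp only [Pi.zero_apply] at hi
  let y : Fin 3 → MvPolynomial (Fin 3) k := fun j => X j - C (b j / b i) * X i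
  have hy : ∀ j, (y j).IsHomogeneous 1 := fun j =>
    (isHomogeneous_X _ _).sub (isHomogeneous_C_mul_X _ _)
  have hyi : y i = 0 := by simp [y, hi]
  have key : F = aeval y F := by
    apply MvPolynomial.funext
    intro x
    have h1 := derivative_line F x b
    rw [h, map_zero] at h1
    have h2 := Polynomial.eq_C_of_natDegree_eq_zero
      (Polynomial.derivative_eq_zero.1 h1)
    set p := aeval (fun i => Polynomial.C (x i) + Polynomial.C (b i) * Polynomial.X) F with hp
    have hev : ∀ t : k, Polynomial.eval t p = eval (fun i => x i + b i * t) F := by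
      intro t
      rw [hp, ← Polynomial.coe_aeval_eq_eval, comp_aeval_apply, ← aeval_eq_eval]
      simp
    have h3 : Polynomial.eval 0 p = Polynomial.eval (- (x i / b i)) p := by
      rw [h2]; simp
    rw [hev, hev] at h3
    simp only [mul_zero, add_zero] at h3
    rw [h3, ← aeval_eq_eval, ← aeval_eq_eval, comp_aeval_apply]
    congr 2
    funext j
    simp [y]
    ring
  refine ⟨fun j => y (i.succAbove j), fun j => hy _,
    aeval (Fin.insertNth (α := fun _ => MvPolynomial (Fin 2) k) i 0 X) F, ?_⟩
  rw [comp_aeval_apply]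
  conv_lhs => rw [key]
  congr 2
  funext j
  refine Fin.succAboveCases i ?_ (fun j => ?_) j
  · simp [hyi]
  · simp

theorem c3_swap {k : Type} [Field k] (F : MvPolynomial (Fin 3) k) (i j l : Fin 3) :
    c3 F i j l = c3 F j i l := by unfold c3; rw [pderiv_swap]

theorem c3_swap' {k : Type} [Field k] (F : MvPolynomial (Fin 3) k) (i j l : Fin 3) :
    c3 F i j l = c3 F i l j := by unfold c3; rw [pderiv_swap j l]

/-- Hessian of the directional derivative -/
def hess {k : Type} [Field k] (F : MvPolynomial (Fin 3) k) (b : Fin 3 → k) (i j : Fin 3) : k :=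
  ∑ l, c3 F i j l * b l

theorem hess_symm {k : Type} [Field k] (F : MvPolynomial (Fin 3) k) (b : Fin 3 → k) (i j : Fin 3) :
    hess F b i j = hess F b j i := by
  unfold hess; simp only [c3_swap F i j]

theorem dir_zero {k : Type} [Field k] [CharZero k] {F : MvPolynomial (Fin 3) k}
    (hF : F.IsHomogeneous 3) (b : Fin 3 → k) (h : ∀ i j, hess F b i j = 0) :
    ∑ i, C (b i) * pderiv i F = 0 := by
  have hh : (∑ i, C (b i) * pderiv i F).IsHomogeneous 2 :=
    IsHomogeneous.sum _ _ _ fun i _ => (hF.pderiv (i := i)).C_mul _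
  have hc : ∀ i j, coeff 0 (pderiv j (pderiv i (∑ i, C (b i) * pderiv i F))) = 0 := by
    intro i j
    rw [← h j i]
    simp only [map_sum, pderiv_C_mul, coeff_sum, coeff_C_mul, hess, c3]
    exact Finset.sum_congr rfl fun l _ => mul_comm _ _
  rw [homog_quad hh]
  simp only [hc]; simp

theorem main_iff {k : Type} [Field k] [CharZero k] {F : MvPolynomial (Fin 3) k}
    (hF : F.IsHomogeneous 3) (hE : EssDep F) :
    (∃ a : Fin 3 → k, a ≠ 0 ∧ ∀ D : MvPolynomial (Fin 3) k,
      D.IsHomogeneous 2 → contract D F = 0 → eval a D = 0) ↔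
    ∃ b : Fin 3 → k, b ≠ 0 ∧ ∀ i j u v, hess F b i j * hess F b u v = hess F b i v * hess F b u j := by
  constructor
  · rintro ⟨a, ha, h⟩
    let L : Fin 3 → (Fin 3 → Fin 3 → k) →ₗ[k] k := fun l =>
      ∑ i, ∑ j, c3 F l i j • ((LinearMap.proj j : (Fin 3 → k) →ₗ[k] k) ∘ₗ
        (LinearMap.proj i : (Fin 3 → Fin 3 → k) →ₗ[k] (Fin 3 → k)))
    let K : (Fin 3 → Fin 3 → k) →ₗ[k] k :=
      ∑ i, ∑ j, (a i * a j) • ((LinearMap.proj j : (Fin 3 → k) →ₗ[k] k) ∘ₗ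
        (LinearMap.proj i : (Fin 3 → Fin 3 → k) →ₗ[k] (Fin 3 → k)))
    have hL : ∀ l d, L l d = ∑ i, ∑ j, d i j * c3 F l i j := by
      intro l d
      simp [L, mul_comm]
    have hK : ∀ d, K d = ∑ i, ∑ j, d i j * (a i * a j) := by
      intro d
      simp [K, mul_comm]
    have hmem : K ∈ Submodule.span k (Set.range L) := by
      apply mem_span_of_iInf_ker_le_ker
      intro d hd
      simp only [Submodule.mem_iInf, LinearMap.mem_ker] at hd ⊢
      have hhom : (∑ i, ∑ j, d i j • (X i * X j) : MvPolynomial (Fin 3) k).IsHomogeneous 2 := by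
        refine IsHomogeneous.sum _ _ _ fun i _ => IsHomogeneous.sum _ _ _ fun j _ => ?_
        rw [smul_eq_C_mul]
        exact ((isHomogeneous_X k i).mul (isHomogeneous_X k j)).C_mul _
      have := h _ hhom ((contract_zero_iff hF d).2 fun l => by rw [← hL]; exact hd l)
      rw [hK, ← this]
      simp [smul_eval]
    obtain ⟨b, hb⟩ := (Submodule.mem_span_range_iff_exists_fun k).1 hmem
    have hab : ∀ i j, hess F b i j = a i * a j := by
      intro i j
      have h1 := congrArg (fun T => T (Pi.single i (Pi.single j 1))) hb
      simp only [LinearMap.sum_apply, LinearMap.smul_apply, hL, hK, smul_eq_mul] at h1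
      have hs : ∀ g : Fin 3 → Fin 3 → k, ∑ i', ∑ j',
          (Pi.single i (Pi.single j 1) : Fin 3 → Fin 3 → k) i' j' * g i' j' = g i j := by
        intro g
        rw [Finset.sum_eq_single i, Finset.sum_eq_single j]
        · simp
        · intro j' _ hj; simp [hj]
        · simp
        · intro i' _ hi; simp [hi]
        · simp
      simp only [hs] at h1
      rw [← h1, hess]
      refine Finset.sum_congr rfl fun l _ => ?_
      rw [mul_comm, c3_swap' F i j l, c3_swap F i l j]
    refine ⟨b, ?_, fun i j u v => by rw [hab, hab, hab, hab]; ring⟩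
    rintro rfl
    obtain ⟨i, hi⟩ := Function.ne_iff.1 ha
    have := hab i i
    simp only [hess, Pi.zero_apply, mul_zero, Finset.sum_const_zero] at this
    exact hi (by simpa using this.symm)
  · rintro ⟨b, hb, h⟩
    have hne : ∃ i, hess F b i i ≠ 0 := by
      by_contra hc
      push Not at hc
      refine hE 2 (by norm_num) (writable_of F b hb (dir_zero hF b fun i j => ?_))
      have h1 := h i j j i
      rw [hc i, zero_mul, hess_symm F b j i] at h1
      exact mul_self_eq_zero.1 h1
    obtain ⟨i, hi⟩ := hne
    refine ⟨fun j => hess F b i j, fun h0 => hi (congrFun h0 i), fun D hD hc => ?_⟩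
    rw [homog_quad hD] at hc ⊢
    set d : Fin 3 → Fin 3 → k := fun i j => coeff 0 (pderiv j (pderiv i D)) / 2 with hd
    have hz := (contract_zero_iff hF d).1 hc
    have e1 : eval (fun j => hess F b i j) (∑ u, ∑ v, d u v • (X u * X v)) =
        ∑ u, ∑ v, d u v * (hess F b i i * hess F b u v) := by
      simp only [map_sum, smul_eval, map_mul, eval_X]
      refine Finset.sum_congr rfl fun u _ => Finset.sum_congr rfl fun v _ => ?_
      rw [h i i u v, hess_symm F b u i]; ring
    have e2 : ∑ u, ∑ v, d u v * (hess F b i i * hess F b u v) =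
        hess F b i i * ∑ l, b l * ∑ u, ∑ v, d u v * c3 F l u v := by
      have : ∀ u v, hess F b u v = ∑ l, c3 F l u v * b l := by
        intro u v
        refine Finset.sum_congr rfl fun l _ => ?_
        rw [c3_swap' F u v l, c3_swap F u l v]
      generalize hess F b i i = z
      simp only [this, Fin.sum_univ_three]
      ring
    rw [e1, e2]
    simp [hz]

/-- universal coefficient -/
def cA (k : Type) [Field k] (i j l : Fin 3) : PolyFun 3 k := ⟨fun F => c3 F i j l, c3_mem i j l⟩

/-- universal Hessian -/
def hessA (k : Type) [Field k] (i j : Fin 3) : MvPolynomial (Fin 3) (PolyFun 3 k) :=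
  ∑ l, C (cA k i j l) * X l

/-- evaluation at `F` -/
def evF {k : Type} [Field k] (F : MvPolynomial (Fin 3) k) : PolyFun 3 k →+* k :=
  (Pi.evalRingHom (fun _ : MvPolynomial (Fin 3) k => k) F).comp (PolyFun 3 k).val.toRingHom

theorem evF_apply {k : Type} [Field k] (F : MvPolynomial (Fin 3) k) (f : PolyFun 3 k) :
    evF F f = (f : MvPolynomial (Fin 3) k → k) F := rfl

theorem eval_hessA {k : Type} [Field k] (F : MvPolynomial (Fin 3) k) (b : Fin 3 → k)
    (i j : Fin 3) : eval b (map (evF F) (hessA k i j)) = hess F b i j := by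
  simp only [hessA, map_sum, map_mul, map_C, map_X, eval_C, eval_X, hess]
  rfl

theorem hessA_homog (k : Type) [Field k] (i j : Fin 3) : (hessA k i j).IsHomogeneous 1 :=
  IsHomogeneous.sum _ _ _ fun _ _ => isHomogeneous_C_mul_X _ _

end Helpers

/-- Within the set `Ess` of ternary cubics essentially depending on three variables, the
subset `W` of forms `F` with `V((F^⊥)₂) ≠ ∅` is Zariski closed (it is `Ess` intersected
with the common zero locus of a family of polynomial functions on `S₃`). -/
theorem stmt_15 (k : Type) [Field k] [IsAlgClosed k] [CharZero k] :
    ∃ P : Set (MvPolynomial (Fin 3) k → k), (∀ f ∈ P, f ∈ PolyFun 3 k) ∧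
      {F : MvPolynomial (Fin 3) k | (F.IsHomogeneous 3 ∧ EssDep F) ∧
          ∃ a : Fin 3 → k, a ≠ 0 ∧
            ∀ D : MvPolynomial (Fin 3) k,
              D.IsHomogeneous 2 → contract D F = 0 → eval a D = 0}
        = {F : MvPolynomial (Fin 3) k | (F.IsHomogeneous 3 ∧ EssDep F) ∧
            ∀ f ∈ P, f F = 0} := by
  obtain ⟨P, hP⟩ := elimination (k := k) (A := PolyFun 3 k)
    (J := Fin 3 × Fin 3 × Fin 3 × Fin 3)
    (fun t => hessA k t.1 t.2.1 * hessA k t.2.2.1 t.2.2.2 -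
      hessA k t.1 t.2.2.2 * hessA k t.2.2.1 t.2.1)
    (fun t => ((hessA_homog k _ _).mul (hessA_homog k _ _)).sub
      ((hessA_homog k _ _).mul (hessA_homog k _ _)))
  refine ⟨(Set.image Subtype.val P), ?_, ?_⟩
  · rintro _ ⟨f, _, rfl⟩
    exact f.2
  · ext F
    simp only [Set.mem_ofPred_eq]
    refine and_congr_right fun hF => ?_
    rw [main_iff hF.1 hF.2]
    have h := hP (evF F)
    simp only [map_sub, map_mul, eval_hessA, sub_eq_zero, Prod.forall] at h
    rw [h]
    simp only [Set.forall_mem_image, evF_apply]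
end

section
/- Let F ∈ S_3 be a cubic form in three variables that essentially depends on three variables and such that V((F^⊥)_2) ⊆ P(S_1) is nonempty. Then, after a linear change of coordinates, F equals either x_0 x_1² + x_1 x_2² or x_0³ + g for some cubic form g ∈ k[x_1, x_2]_3. -/
open MvPolynomial

namespace Cub
variable {k : Type} [Field k]

/-- Trilinear form with coefficients `f`. -/
def T (f : Fin 3 → Fin 3 → Fin 3 → k) (u v w : Fin 3 → k) : k :=
  ∑ i, ∑ j, ∑ l, f i j l * u i * v j * w l

/-- The linear functional given by `a`. -/
def lin (a u : Fin 3 → k) : k := ∑ i, a i * u i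

theorem T_add (f : Fin 3 → Fin 3 → Fin 3 → k) (u u' v w) :
    T f (u + u') v w = T f u v w + T f u' v w := by
  simp only [T, ← Finset.sum_add_distrib, Pi.add_apply]
  refine Finset.sum_congr rfl fun i _ => Finset.sum_congr rfl fun j _ =>
    Finset.sum_congr rfl fun l _ => by ring

theorem T_smul (f : Fin 3 → Fin 3 → Fin 3 → k) (c : k) (u v w) :
    T f (c • u) v w = c * T f u v w := by
  simp only [T, Finset.mul_sum, Pi.smul_apply, smul_eq_mul]
  refine Finset.sum_congr rfl fun i _ => Finset.sum_congr rfl fun j _ =>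
    Finset.sum_congr rfl fun l _ => by ring

theorem T_swap (f : Fin 3 → Fin 3 → Fin 3 → k) (h : ∀ i j l, f i j l = f j i l) (u v w) :
    T f u v w = T f v u w := by
  simp only [T]
  rw [Finset.sum_comm]
  refine Finset.sum_congr rfl fun i _ => Finset.sum_congr rfl fun j _ =>
    Finset.sum_congr rfl fun l _ => by rw [h]; ring

theorem T_swap' (f : Fin 3 → Fin 3 → Fin 3 → k) (h : ∀ i j l, f i j l = f i l j) (u v w) :
    T f u v w = T f u w v := by
  simp only [T]
  refine Finset.sum_congr rfl fun i _ => ?_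
  rw [Finset.sum_comm]
  refine Finset.sum_congr rfl fun j _ =>
    Finset.sum_congr rfl fun l _ => by rw [h]; ring

theorem lin_add (a u v : Fin 3 → k) : lin a (u + v) = lin a u + lin a v := by
  simp only [lin, Fin.sum_univ_three, Pi.add_apply]; ring

theorem lin_smul (a : Fin 3 → k) (c : k) (u : Fin 3 → k) : lin a (c • u) = c * lin a u := by
  simp only [lin, Fin.sum_univ_three, Pi.smul_apply, smul_eq_mul]; ring

/-- Exponent vector. -/
noncomputable def e (p : ℕ × ℕ × ℕ) : Fin 3 →₀ ℕ := Finsupp.equivFunOnFinite.symm ![p.1, p.2.1, p.2.2]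

theorem e_inj : Function.Injective e := by
  intro p q h
  have h0 := DFunLike.congr_fun h 0
  have h1 := DFunLike.congr_fun h 1
  have h2 := DFunLike.congr_fun h 2
  simp [e] at h0 h1 h2
  ext <;> assumption

/-- The exponents of cubic monomials. -/
def S10 : Finset (ℕ × ℕ × ℕ) :=
  {(3,0,0),(2,1,0),(2,0,1),(1,2,0),(1,1,1),(1,0,2),(0,3,0),(0,2,1),(0,1,2),(0,0,3)}

theorem mem_S10 (a b c : ℕ) (h : a + b + c = 3) : (a,b,c) ∈ S10 := by
  have ha : a ≤ 3 := by omega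
  have hb : b ≤ 3 := by omega
  obtain rfl : c = 3 - a - b := by omega
  interval_cases a <;> interval_cases b <;> simp_all [S10]

theorem eval_ten (F : MvPolynomial (Fin 3) k) (hF : F.IsHomogeneous 3) (v : Fin 3 → k) :
    eval v F = ∑ p ∈ S10, coeff (e p) F * (v 0 ^ p.1 * v 1 ^ p.2.1 * v 2 ^ p.2.2) := by
  rw [eval_eq']
  have hsub : F.support ⊆ S10.image e := by
    intro s hs
    have h3 : s 0 + s 1 + s 2 = 3 := by
      have := hF (mem_support_iff.1 hs)
      simpa [Finsupp.weight_apply, Finsupp.sum_fintype, Fin.sum_univ_three] using this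
    refine Finset.mem_image.2 ⟨(s 0, s 1, s 2), mem_S10 _ _ _ h3, ?_⟩
    ext i; fin_cases i <;> simp [e]
  rw [Finset.sum_subset hsub]
  · rw [Finset.sum_image (fun _ _ _ _ h => e_inj h)]
    refine Finset.sum_congr rfl fun p _ => ?_
    simp [Fin.prod_univ_three, e]
  · intro s _ hs
    rw [notMem_support_iff.1 hs, zero_mul]

theorem exists_T [CharZero k] (F : MvPolynomial (Fin 3) k) (hF : F.IsHomogeneous 3) :
    ∃ f : Fin 3 → Fin 3 → Fin 3 → k, (∀ i j l, f i j l = f j i l) ∧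
      (∀ i j l, f i j l = f i l j) ∧ ∀ v, eval v F = T f v v v := by
  obtain ⟨c, hc⟩ : ∃ c : ℕ → ℕ → ℕ → k, ∀ x y z, c x y z = coeff (e (x,y,z)) F :=
    ⟨fun x y z => coeff (e (x,y,z)) F, fun _ _ _ => rfl⟩
  refine ⟨![![![c 3 0 0, c 2 1 0 / 3, c 2 0 1 / 3], ![c 2 1 0 / 3, c 1 2 0 / 3, c 1 1 1 / 6],
        ![c 2 0 1 / 3, c 1 1 1 / 6, c 1 0 2 / 3]],
      ![![c 2 1 0 / 3, c 1 2 0 / 3, c 1 1 1 / 6], ![c 1 2 0 / 3, c 0 3 0, c 0 2 1 / 3],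
        ![c 1 1 1 / 6, c 0 2 1 / 3, c 0 1 2 / 3]],
      ![![c 2 0 1 / 3, c 1 1 1 / 6, c 1 0 2 / 3], ![c 1 1 1 / 6, c 0 2 1 / 3, c 0 1 2 / 3],
        ![c 1 0 2 / 3, c 0 1 2 / 3, c 0 0 3]]], ?_, ?_, ?_⟩
  · intro i j l; fin_cases i <;> fin_cases j <;> fin_cases l <;> rfl
  · intro i j l; fin_cases i <;> fin_cases j <;> fin_cases l <;> rfl
  · intro v
    rw [eval_ten F hF]
    simp [S10, ← hc, T, Fin.sum_univ_three]
    field_simp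
    ring

theorem contract_eq (D F : MvPolynomial (Fin 3) k) (U : Finset (Fin 3 →₀ ℕ))
    (h : D.support ⊆ U) : contract D F = ∑ s ∈ U, D.coeff s •
    ((List.finRange 3).foldr (fun i G => (fun H => pderiv i H)^[s i] G) F) := by
  unfold contract
  refine Finset.sum_subset h fun s _ hs => ?_
  rw [notMem_support_iff.1 hs, zero_smul]

theorem contract_add (D E F : MvPolynomial (Fin 3) k) :
    contract (D + E) F = contract D F + contract E F := by
  classical
  rw [contract_eq (D + E) F (D.support ∪ E.support) support_add,
    contract_eq D F _ Finset.subset_union_left, contract_eq E F _ Finset.subset_union_right,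
    ← Finset.sum_add_distrib]
  refine Finset.sum_congr rfl fun s _ => ?_
  rw [coeff_add, add_smul]

theorem contract_zero (F : MvPolynomial (Fin 3) k) : contract 0 F = 0 := by
  simp [contract]

theorem contract_sum {ι : Type} (s : Finset ι) (D : ι → MvPolynomial (Fin 3) k)
    (F : MvPolynomial (Fin 3) k) : contract (∑ i ∈ s, D i) F = ∑ i ∈ s, contract (D i) F := by
  classical
  induction s using Finset.induction_on with
  | empty => simp [contract_zero]
  | insert i s hi ih => rw [Finset.sum_insert hi, Finset.sum_insert hi, contract_add, ih]

theorem contract_mono (i j : Fin 3) (c : k) (F : MvPolynomial (Fin 3) k) :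
    contract (monomial (Finsupp.single i 1 + Finsupp.single j 1) c) F
      = c • pderiv i (pderiv j F) := by
  rw [contract_eq _ F {Finsupp.single i 1 + Finsupp.single j 1} support_monomial_subset]
  have comm : ∀ i j : Fin 3, pderiv i (pderiv j F) = pderiv j (pderiv i F) := by
    intro i j
    have : ⁅(pderiv i : Derivation k (MvPolynomial (Fin 3) k) (MvPolynomial (Fin 3) k)),
        (pderiv j : Derivation k (MvPolynomial (Fin 3) k) (MvPolynomial (Fin 3) k))⁆ = 0 := by
      apply MvPolynomial.derivation_ext
      intro l
      simp only [Derivation.commutator_apply, pderiv_X, Pi.single_apply]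
      split_ifs <;> simp
    have h := DFunLike.congr_fun this F
    rw [Derivation.commutator_apply] at h
    exact sub_eq_zero.1 h
  simp only [Finset.sum_singleton, coeff_monomial, if_true]
  congr 1
  rw [show List.finRange 3 = [0,1,2] from rfl]
  fin_cases i <;> fin_cases j <;> simp [comm 1 0, comm 2 0, comm 2 1]

theorem poly_eq [CharZero k] (F : MvPolynomial (Fin 3) k) (f : Fin 3 → Fin 3 → Fin 3 → k)
    (h : ∀ v, eval v F = T f v v v) :
    F = ∑ i, ∑ j, ∑ l, C (f i j l) * X i * X j * X l := by
  apply MvPolynomial.funext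
  intro v
  rw [h]
  simp [T]

theorem pderiv2 [CharZero k] (F : MvPolynomial (Fin 3) k) (f : Fin 3 → Fin 3 → Fin 3 → k)
    (h1 : ∀ i j l, f i j l = f j i l) (h2 : ∀ i j l, f i j l = f i l j)
    (h : ∀ v, eval v F = T f v v v) (i j : Fin 3) :
    pderiv i (pderiv j F) = ∑ l, C (6 * f i j l) * X l := by
  rw [poly_eq F f h]
  have e1 : f 1 0 0 = f 0 0 1 := by rw [h1, h2]
  have e2 : f 0 1 0 = f 0 0 1 := by rw [h2]
  have e3 : f 2 0 0 = f 0 0 2 := by rw [h1, h2]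
  have e4 : f 0 2 0 = f 0 0 2 := by rw [h2]
  have e5 : f 1 0 1 = f 0 1 1 := by rw [h1]
  have e6 : f 1 1 0 = f 0 1 1 := by rw [h2, h1]
  have e7 : f 2 0 2 = f 0 2 2 := by rw [h1]
  have e8 : f 2 2 0 = f 0 2 2 := by rw [h2, h1]
  have e9 : f 2 1 1 = f 1 1 2 := by rw [h1, h2]
  have e10 : f 1 2 1 = f 1 1 2 := by rw [h2]
  have e11 : f 2 1 2 = f 1 2 2 := by rw [h1]
  have e12 : f 2 2 1 = f 1 2 2 := by rw [h2, h1]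
  have e13 : f 0 2 1 = f 0 1 2 := by rw [h2]
  have e14 : f 1 0 2 = f 0 1 2 := by rw [h1]
  have e15 : f 1 2 0 = f 0 1 2 := by rw [h2, h1]
  have e16 : f 2 0 1 = f 0 1 2 := by rw [h1, h2]
  have e17 : f 2 1 0 = f 0 1 2 := by rw [h2, h1, h2]
  have c6 : (C 6 : MvPolynomial (Fin 3) k) = 6 := map_ofNat C 6
  simp only [Fin.sum_univ_three, e1, e2, e3, e4, e5, e6, e7, e8, e9, e10, e11, e12, e13, e14,
    e15, e16, e17]
  fin_cases j <;> fin_cases i <;>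
  · simp [pderiv_X, Derivation.leibniz, e1, e2, e3, e4, e5, e6, e7, e8, e9, e10, e11, e12, e13,
      e14, e15, e16, e17, c6]
    ring

theorem exists_b [CharZero k] (F : MvPolynomial (Fin 3) k) (f : Fin 3 → Fin 3 → Fin 3 → k)
    (h1 : ∀ i j l, f i j l = f j i l) (h2 : ∀ i j l, f i j l = f i l j)
    (h : ∀ v, eval v F = T f v v v) (a : Fin 3 → k)
    (ha : ∀ D : MvPolynomial (Fin 3) k, D.IsHomogeneous 2 → contract D F = 0 → eval a D = 0) :
    ∃ b : Fin 3 → k, ∀ u w, T f b u w = lin a u * lin a w := by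
  let L : (Fin 3 × Fin 3 → k) →ₗ[k] (Fin 3 → k) :=
    LinearMap.pi fun l => ∑ p : Fin 3 × Fin 3, (f p.1 p.2 l) • LinearMap.proj p
  let φ : (Fin 3 × Fin 3 → k) →ₗ[k] k := ∑ p : Fin 3 × Fin 3, (a p.1 * a p.2) • LinearMap.proj p
  have hker : L.ker ≤ φ.ker := by
    intro d hd
    rw [LinearMap.mem_ker] at hd ⊢
    have hd' : ∀ l, ∑ p : Fin 3 × Fin 3, f p.1 p.2 l * d p = 0 := by
      intro l
      have := congr_fun hd l
      simpa [L] using this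
    have := ha (∑ p : Fin 3 × Fin 3, monomial (Finsupp.single p.1 1 + Finsupp.single p.2 1) (d p))
      (by
        refine IsHomogeneous.sum _ _ _ fun p _ => isHomogeneous_monomial _ ?_
        simp)
      (by
        rw [contract_sum]
        simp only [contract_mono, pderiv2 F f h1 h2 h, Finset.smul_sum]
        rw [Finset.sum_comm]
        refine Finset.sum_eq_zero fun l _ => ?_
        have h6 : ∑ p : Fin 3 × Fin 3, d p • (C (6 * f p.1 p.2 l) * X l : MvPolynomial (Fin 3) k)
            = C (6 * ∑ p : Fin 3 × Fin 3, f p.1 p.2 l * d p) * X l := by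
          simp only [Finset.mul_sum, map_sum, Finset.sum_mul]
          refine Finset.sum_congr rfl fun p _ => ?_
          rw [smul_eq_C_mul]
          simp only [map_mul]
          ring
        rw [h6, hd' l]; simp)
    simp only [map_sum, eval_monomial] at this
    rw [← this]
    simp only [φ, LinearMap.sum_apply, LinearMap.smul_apply, LinearMap.proj_apply, smul_eq_mul]
    refine Finset.sum_congr rfl fun p _ => ?_
    rw [Finsupp.prod_add_index' (by simp) (by intros; rw [pow_add])]
    simp
    ring
  obtain ⟨ψ, hψ⟩ : ∃ ψ : (Fin 3 → k) →ₗ[k] k, ψ ∘ₗ L = φ := by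
    have : φ ∈ L.dualMap.range := by
      rw [LinearMap.range_dualMap_eq_dualAnnihilator_ker, Submodule.mem_dualAnnihilator]
      exact fun w hw => hker hw
    obtain ⟨ψ, hψ⟩ := this
    exact ⟨ψ, hψ⟩
  have key : ∀ i j, a i * a j = ∑ l, f i j l * ψ (Pi.single l 1) := by
    intro i j
    have h0 := LinearMap.congr_fun hψ (Pi.single (i,j) 1)
    have e1 : φ (Pi.single (i,j) 1) = a i * a j := by
      simp [φ, Pi.single_apply]
    have e2 : L (Pi.single (i,j) 1) = ∑ l, f i j l • (Pi.single l 1 : Fin 3 → k) := by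
      ext l
      simp [L, Pi.single_apply, Finset.sum_apply]
    rw [LinearMap.comp_apply, e1, e2] at h0
    rw [← h0]
    simp
  refine ⟨fun l => ψ (Pi.single l 1), fun u w => ?_⟩
  rw [T_swap f h1, T_swap' f h2]
  simp only [lin, Finset.sum_mul_sum, T]
  refine Finset.sum_congr rfl fun i _ => Finset.sum_congr rfl fun j _ => ?_
  rw [show a i * u i * (a j * w j) = (a i * a j) * (u i * w j) by ring, key, Finset.sum_mul]
  exact Finset.sum_congr rfl fun l _ => by ring

/-- Matrix with the given columns. -/
def cols (p q r : Fin 3 → k) : Matrix (Fin 3) (Fin 3) k := fun i j => ![p i, q i, r i] j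

theorem det_cols (p q r : Fin 3 → k) : (cols p q r).det =
    p 0 * (q 1 * r 2 - q 2 * r 1) - q 0 * (p 1 * r 2 - p 2 * r 1)
      + r 0 * (p 1 * q 2 - p 2 * q 1) := by
  rw [Matrix.det_fin_three]; simp [cols]; ring

theorem T_expand (f : Fin 3 → Fin 3 → Fin 3 → k)
    (h1 : ∀ i j l, f i j l = f j i l) (h2 : ∀ i j l, f i j l = f i l j) (p q r) (x y z : k) :
    T f (x • p + y • q + z • r) (x • p + y • q + z • r) (x • p + y • q + z • r) =
      T f p p p * x ^ 3 + 3 * T f p p q * x ^ 2 * y + 3 * T f p p r * x ^ 2 * z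
      + 3 * T f p q q * x * y ^ 2 + 6 * T f p q r * x * y * z + 3 * T f p r r * x * z ^ 2
      + T f q q q * y ^ 3 + 3 * T f q q r * y ^ 2 * z + 3 * T f q r r * y * z ^ 2
      + T f r r r * z ^ 3 := by
  have s1 := T_swap f h1
  have s2 := T_swap' f h2
  have a2 : ∀ u v v' w, T f u (v + v') w = T f u v w + T f u v' w := by
    intro u v v' w; rw [s1, T_add, s1 v, s1 v']
  have m2 : ∀ (c : k) u v w, T f u (c • v) w = c * T f u v w := by
    intro c u v w; rw [s1, T_smul, s1 v]
  have a3 : ∀ u v w w', T f u v (w + w') = T f u v w + T f u v w' := by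
    intro u v v' w; rw [s2, a2, s2 u v', s2 u w]
  have m3 : ∀ (c : k) u v w, T f u v (c • w) = c * T f u v w := by
    intro c u v w; rw [s2, m2, s2 u w]
  simp only [T_add, T_smul, a2, m2, a3, m3]
  have e1 : T f q p p = T f p p q := by rw [s1, s2]
  have e2 : T f p q p = T f p p q := by rw [s2]
  have e3 : T f r p p = T f p p r := by rw [s1, s2]
  have e4 : T f p r p = T f p p r := by rw [s2]
  have e5 : T f q p q = T f p q q := by rw [s1]
  have e6 : T f q q p = T f p q q := by rw [s2, s1]
  have e7 : T f r p r = T f p r r := by rw [s1]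
  have e8 : T f r r p = T f p r r := by rw [s2, s1]
  have e9 : T f r q q = T f q q r := by rw [s1, s2]
  have e10 : T f q r q = T f q q r := by rw [s2]
  have e11 : T f r q r = T f q r r := by rw [s1]
  have e12 : T f r r q = T f q r r := by rw [s2, s1]
  have e13 : T f p r q = T f p q r := by rw [s2]
  have e14 : T f q p r = T f p q r := by rw [s1]
  have e15 : T f q r p = T f p q r := by rw [s2, s1]
  have e16 : T f r p q = T f p q r := by rw [s1, s2]
  have e17 : T f r q p = T f p q r := by rw [s2, s1, s2]
  rw [e1, e2, e3, e4, e5, e6, e7, e8, e9, e10, e11, e12, e13, e14, e15, e16, e17]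
  ring

theorem eval_cols (F : MvPolynomial (Fin 3) k) (f : Fin 3 → Fin 3 → Fin 3 → k)
    (h : ∀ v, eval v F = T f v v v) (p q r x : Fin 3 → k) :
    eval x (aeval (fun i => ∑ j, C (cols p q r i j) * X j) F) =
     T f (x 0 • p + x 1 • q + x 2 • r) (x 0 • p + x 1 • q + x 2 • r)
      (x 0 • p + x 1 • q + x 2 • r) := by
  rw [← h, ← coe_aeval_eq_eval, ← coe_aeval_eq_eval]
  simp only [RingHom.coe_coe]
  rw [← AlgHom.comp_apply, comp_aeval]
  congr 2
  funext i
  simp [Fin.sum_univ_three, cols]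
  ring

/-- Goal predicate. -/
def Goal (F : MvPolynomial (Fin 3) k) : Prop :=
    ∃ A : Matrix (Fin 3) (Fin 3) k, IsUnit A.det ∧
      (aeval (fun i => ∑ j, C (A i j) * X j) F
          = (X 0 * X 1 ^ 2 + X 1 * X 2 ^ 2 : MvPolynomial (Fin 3) k) ∨
        ∃ g : MvPolynomial (Fin 3) k, g.IsHomogeneous 3 ∧ (∀ s ∈ g.support, s 0 = 0) ∧
          aeval (fun i => ∑ j, C (A i j) * X j) F = X 0 ^ 3 + g)

theorem goal_right [CharZero k] (F : MvPolynomial (Fin 3) k) (f : Fin 3 → Fin 3 → Fin 3 → k)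
    (h1 : ∀ i j l, f i j l = f j i l) (h2 : ∀ i j l, f i j l = f i l j)
    (h : ∀ v, eval v F = T f v v v) (p q r : Fin 3 → k) (hd : (cols p q r).det ≠ 0)
    (hppp : T f p p p = 1) (hppq : T f p p q = 0) (hppr : T f p p r = 0)
    (hpqq : T f p q q = 0) (hpqr : T f p q r = 0) (hprr : T f p r r = 0) : Goal F := by
  classical
  refine ⟨cols p q r, isUnit_iff_ne_zero.2 hd, Or.inr ⟨monomial (e (0,3,0)) (T f q q q) +
    monomial (e (0,2,1)) (3 * T f q q r) + monomial (e (0,1,2)) (3 * T f q r r) +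
    monomial (e (0,0,3)) (T f r r r), ?_, ?_, ?_⟩⟩
  · refine (((?_ : IsHomogeneous _ 3).add ?_).add ?_).add ?_ <;>
    · apply isHomogeneous_monomial
      simp [e, Finsupp.degree_eq_sum, Fin.sum_univ_three]
  · intro s hs
    have hs' := support_add hs
    rw [Finset.mem_union] at hs'
    rcases hs' with hs' | hs'
    · have hs2 := support_add hs'
      rw [Finset.mem_union] at hs2
      rcases hs2 with hs2 | hs2
      · have hs3 := support_add hs2
        rw [Finset.mem_union] at hs3
        rcases hs3 with hs3 | hs3 <;>
        · rw [Finset.mem_singleton.1 (support_monomial_subset hs3)]; simp [e]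
      · rw [Finset.mem_singleton.1 (support_monomial_subset hs2)]; simp [e]
    · rw [Finset.mem_singleton.1 (support_monomial_subset hs')]; simp [e]
  · apply MvPolynomial.funext
    intro x
    rw [eval_cols F f h, T_expand f h1 h2, hppp, hppq, hppr, hpqq, hpqr, hprr]
    simp [eval_monomial, e, Finsupp.prod_fintype, Fin.prod_univ_three]
    ring

theorem goal_left [CharZero k] (F : MvPolynomial (Fin 3) k) (f : Fin 3 → Fin 3 → Fin 3 → k)
    (h1 : ∀ i j l, f i j l = f j i l) (h2 : ∀ i j l, f i j l = f i l j)
    (h : ∀ v, eval v F = T f v v v) (p q r : Fin 3 → k) (hd : (cols p q r).det ≠ 0)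
    (hppp : T f p p p = 0) (hppq : T f p p q = 0) (hppr : T f p p r = 0)
    (hpqq : 3 * T f p q q = 1) (hpqr : T f p q r = 0) (hprr : T f p r r = 0)
    (hqqq : T f q q q = 0) (hqqr : T f q q r = 0) (hqrr : 3 * T f q r r = 1)
    (hrrr : T f r r r = 0) : Goal F := by
  refine ⟨cols p q r, isUnit_iff_ne_zero.2 hd, Or.inl ?_⟩
  apply MvPolynomial.funext
  intro x
  rw [eval_cols F f h, T_expand f h1 h2, hppp, hppq, hppr, hpqq, hpqr, hprr, hqqq, hqqr, hqrr,
    hrrr]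
  simp

theorem writable [CharZero k] (F : MvPolynomial (Fin 3) k) (f : Fin 3 → Fin 3 → Fin 3 → k)
    (h1 : ∀ i j l, f i j l = f j i l) (h2 : ∀ i j l, f i j l = f i l j)
    (h : ∀ v, eval v F = T f v v v) (p q r : Fin 3 → k) (hd : (cols p q r).det ≠ 0)
    (hppp : T f p p p = 0) (hppq : T f p p q = 0) (hppr : T f p p r = 0)
    (hpqr : T f p q r = 0) (hprr : T f p r r = 0)
    (hqrr : T f q r r = 0) (hrrr : T f r r r = 0) : WritableIn 2 F := by
  let B := (cols p q r)⁻¹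
  have hB : ∀ x, (cols p q r).mulVec (B.mulVec x) = x := by
    intro x
    rw [Matrix.mulVec_mulVec, Matrix.mul_nonsing_inv _ (isUnit_iff_ne_zero.2 hd),
      Matrix.one_mulVec]
  let y : Fin 3 → MvPolynomial (Fin 3) k := fun i => ∑ j, C (B i j) * X j
  have hy : ∀ i, (y i).IsHomogeneous 1 := fun i =>
    IsHomogeneous.sum _ _ _ fun j _ => isHomogeneous_C_mul_X _ _
  have hye : ∀ x i, eval x (y i) = B.mulVec x i := by
    intro x i
    simp [y, Matrix.mulVec, dotProduct]
  refine ⟨![y 1, C (3 * T f p q q) * y 0 + C (T f q q q) * y 1 + C (3 * T f q q r) * y 2], ?_,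
    X 0 ^ 2 * X 1, ?_⟩
  · intro j
    fin_cases j
    · exact hy 1
    · exact (((hy 0).C_mul _).add ((hy 1).C_mul _)).add ((hy 2).C_mul _)
  · apply MvPolynomial.funext
    intro x
    have hx : x = B.mulVec x 0 • p + B.mulVec x 1 • q + B.mulVec x 2 • r := by
      conv_lhs => rw [← hB x]
      ext i
      simp [Matrix.mulVec, dotProduct, Fin.sum_univ_three, cols]
      ring
    rw [h]
    conv_lhs => rw [hx]
    rw [T_expand f h1 h2, hppp, hppq, hppr, hpqr, hprr, hqrr, hrrr]
    simp [hye]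
    ring

theorem basis1 (a b : Fin 3 → k) (hb : lin a b ≠ 0) :
    ∃ q r, lin a q = 0 ∧ lin a r = 0 ∧ (cols b q r).det ≠ 0 := by
  have hne : a 0 ≠ 0 ∨ a 1 ≠ 0 ∨ a 2 ≠ 0 := by
    by_contra! hc
    exact hb (by simp [lin, Fin.sum_univ_three, hc])
  rcases hne with h | h | h
  · refine ⟨![-a 1, a 0, 0], ![-a 2, 0, a 0], ?_, ?_, ?_⟩
    · simp [lin, Fin.sum_univ_three]; ring
    · simp [lin, Fin.sum_univ_three]; ring
    · have : (cols b ![-a 1, a 0, 0] ![-a 2, 0, a 0]).det = a 0 * lin a b := by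
        rw [det_cols]; simp [lin, Fin.sum_univ_three]; ring
      rw [this]; exact mul_ne_zero h hb
  · refine ⟨![a 1, -a 0, 0], ![0, -a 2, a 1], ?_, ?_, ?_⟩
    · simp [lin, Fin.sum_univ_three]; ring
    · simp [lin, Fin.sum_univ_three]; ring
    · have : (cols b ![a 1, -a 0, 0] ![0, -a 2, a 1]).det = - a 1 * lin a b := by
        rw [det_cols]; simp [lin, Fin.sum_univ_three]; ring
      rw [this]; exact mul_ne_zero (neg_ne_zero.2 h) hb
  · refine ⟨![a 2, 0, -a 0], ![0, a 2, -a 1], ?_, ?_, ?_⟩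
    · simp [lin, Fin.sum_univ_three]; ring
    · simp [lin, Fin.sum_univ_three]; ring
    · have : (cols b ![a 2, 0, -a 0] ![0, a 2, -a 1]).det = a 2 * lin a b := by
        rw [det_cols]; simp [lin, Fin.sum_univ_three]; ring
      rw [this]; exact mul_ne_zero h hb

theorem basis2 (a b : Fin 3 → k) (ha : a ≠ 0) (hb0 : b ≠ 0) (hb : lin a b = 0) :
    ∃ q r, lin a q = 1 ∧ lin a r = 0 ∧ (cols b q r).det ≠ 0 := by
  obtain ⟨q, hq⟩ : ∃ q, lin a q = 1 := by
    obtain ⟨i, hi⟩ := Function.ne_iff.1 ha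
    refine ⟨Pi.single i (a i)⁻¹, ?_⟩
    simp only [Pi.zero_apply] at hi
    simp [lin, Pi.single_apply, hi]
  obtain ⟨r, s, hr, hs, hd⟩ := basis1 a q (by rw [hq]; exact one_ne_zero)
  by_cases hbr : (cols b q r).det = 0
  · by_cases hbs : (cols b q s).det = 0
    · exfalso
      apply hb0
      -- Cramer
      have hB : IsUnit (cols q r s).det := isUnit_iff_ne_zero.2 hd
      have hx : ∀ i, (cols q r s).det * b i = (cols b r s).det * q i
          + (cols b q s).det * (- r i) + (cols b q r).det * s i := by
        intro i
        simp only [det_cols]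
        fin_cases i <;> simp <;> ring
      have hl : (cols q r s).det * lin a b = (cols b r s).det * lin a q := by
        have : (cols q r s).det * lin a b = (cols b r s).det * lin a q
          + (cols b q s).det * (- lin a r) + (cols b q r).det * lin a s := by
          simp only [lin, Fin.sum_univ_three]
          linear_combination a 0 * hx 0 + a 1 * hx 1 + a 2 * hx 2
        rw [this, hbr, hbs]; ring
      rw [hb, hq, mul_zero, mul_one] at hl
      ext i
      have := hx i
      rw [← hl, hbr, hbs] at this
      simpa [hd] using this
    · exact ⟨q, s, hq, hs, hbs⟩
  · exact ⟨q, r, hq, hr, hbr⟩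

theorem main [IsAlgClosed k] [CharZero k]
    (F : MvPolynomial (Fin 3) k) (hF : F.IsHomogeneous 3) (hess : EssDep F)
    (hbp : ∃ a : Fin 3 → k, a ≠ 0 ∧
      ∀ D : MvPolynomial (Fin 3) k, D.IsHomogeneous 2 → contract D F = 0 → eval a D = 0) :
    Goal F := by
  obtain ⟨f, h1, h2, h⟩ := exists_T F hF
  obtain ⟨a, ha, hD⟩ := hbp
  obtain ⟨b, hb⟩ := exists_b F f h1 h2 h a hD
  have s1 := T_swap f h1
  have s2 := T_swap' f h2
  have a2 : ∀ u v v' w, T f u (v + v') w = T f u v w + T f u v' w := by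
    intro u v v' w; rw [s1, T_add, s1 v, s1 v']
  have m2 : ∀ (c : k) u v w, T f u (c • v) w = c * T f u v w := by
    intro c u v w; rw [s1, T_smul, s1 v]
  have a3 : ∀ u v w w', T f u v (w + w') = T f u v w + T f u v w' := by
    intro u v v' w; rw [s2, a2, s2 u v', s2 u w]
  have m3 : ∀ (c : k) u v w, T f u v (c • w) = c * T f u v w := by
    intro c u v w; rw [s2, m2, s2 u w]
  have hb2 : ∀ u w, T f u b w = lin a u * lin a w := fun u w => by rw [s1, hb]
  have hb3 : ∀ u w, T f u w b = lin a u * lin a w := fun u w => by rw [s2, hb2]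
  by_cases hl : lin a b = 0
  · have hb0 : b ≠ 0 := by
      rintro rfl
      obtain ⟨i, hi⟩ := Function.ne_iff.1 ha
      have := hb (Pi.single i 1) (Pi.single i 1)
      simp [T, lin, Pi.single_apply] at this
      exact hi this
    obtain ⟨q, r, hq, hr, hd⟩ := basis2 a b ha hb0 hl
    rw [det_cols] at hd
    by_cases hα : T f r r r = 0
    · by_cases hβ : T f q r r = 0
      · exfalso
        refine hess 2 (by norm_num) (writable F f h1 h2 h b q r (by rwa [det_cols])
          ?_ ?_ ?_ ?_ ?_ hβ hα) <;> simp [hb, hl, hr]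
      · obtain ⟨t, ht⟩ := IsAlgClosed.exists_pow_nat_eq (3 * T f q r r)⁻¹ (n := 2) (by norm_num)
        have ht' : 3 * t ^ 2 * T f q r r = 1 := by rw [ht]; field_simp
        have ht0 : t ≠ 0 := by rintro rfl; simp at ht'
        have hrq1 : T f r q r = T f q r r := s1 _ _ _
        have hrq2 : T f r r q = T f q r r := by rw [s2, s1]
        have hqr1 : T f q r q = T f q q r := s2 _ _ _
        have hqr2 : T f r q q = T f q q r := by rw [s1, s2]
        refine goal_left F f h1 h2 h ((3:k)⁻¹ • b) (q + (-(T f q q q) / 3) • b)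
          (t • r + (-(t * T f q q r)) • b) ?_ ?_ ?_ ?_ ?_ ?_ ?_ ?_ ?_ ?_ ?_
        · rw [det_cols]
          have : (3:k)⁻¹ * t ≠ 0 := by simp [ht0]
          convert mul_ne_zero this hd using 1
          simp
          ring
        all_goals
          simp only [T_add, T_smul, a2, m2, a3, m3, lin_add, lin_smul, hb, hb2, hb3, hl, hq, hr,
            hα, hrq1, hrq2, hqr1, hqr2]
          try field_simp
          try ring
        linear_combination ht'
    · obtain ⟨t, ht⟩ := IsAlgClosed.exists_pow_nat_eq (T f r r r)⁻¹ (n := 3) (by norm_num)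
      have ht' : t ^ 3 * T f r r r = 1 := by rw [ht]; field_simp
      have ht0 : t ≠ 0 := by rintro rfl; simp at ht'
      have hrq1 : T f r q r = T f q r r := s1 _ _ _
      have hrq2 : T f r r q = T f q r r := by rw [s2, s1]
      have hqr1 : T f q r q = T f q q r := s2 _ _ _
      have hqr2 : T f r q q = T f q q r := by rw [s1, s2]
      obtain ⟨m, hm⟩ : ∃ m, T f q r r + m * T f r r r = 0 :=
        ⟨-(T f q r r) / T f r r r, by field_simp; ring⟩
      obtain ⟨n, hn⟩ : ∃ n, T f q q r + 2 * m * T f q r r + m ^ 2 * T f r r r + n = 0 :=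
        ⟨_, add_neg_cancel _⟩
      refine goal_right F f h1 h2 h (t • (r + n • b)) (q + m • r) b ?_ ?_ ?_ ?_ ?_ ?_ ?_
      · rw [det_cols]
        convert mul_ne_zero (neg_ne_zero.2 ht0) hd using 1
        simp
        ring
      all_goals
        simp only [T_add, T_smul, a2, m2, a3, m3, lin_add, lin_smul, hb, hb2, hb3, hl, hq, hr,
            hrq1, hrq2, hqr1, hqr2]
      · linear_combination ht'
      · linear_combination t ^ 2 * hm
      · ring
      · linear_combination t * hn
      · ring
      · ring
  · obtain ⟨q, r, hq, hr, hd⟩ := basis1 a b hl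
    obtain ⟨t, ht⟩ := IsAlgClosed.exists_pow_nat_eq ((lin a b) ^ 2)⁻¹ (n := 3) (by norm_num)
    have ht' : t ^ 3 * (lin a b) ^ 2 = 1 := by rw [ht]; field_simp
    have ht0 : t ≠ 0 := by rintro rfl; simp at ht'
    rw [det_cols] at hd
    refine goal_right F f h1 h2 h (t • b) q r ?_ ?_ ?_ ?_ ?_ ?_ ?_
    · rw [det_cols]
      convert mul_ne_zero ht0 hd using 1
      simp
      ring
    all_goals
      simp only [T_add, T_smul, a2, m2, a3, m3, lin_add, lin_smul, hb, hb2, hb3, hq, hr]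
    · linear_combination ht'
    all_goals ring

end Cub

/-- A ternary cubic `F` essentially depending on three variables and with
`V((F^⊥)₂) ≠ ∅` is, after a linear change of coordinates, either `x₀x₁² + x₁x₂²` or
`x₀³ + g` with `g ∈ k[x₁,x₂]₃`. -/
theorem stmt_16 (k : Type) [Field k] [IsAlgClosed k] [CharZero k]
    (F : MvPolynomial (Fin 3) k) (hF : F.IsHomogeneous 3) (hess : EssDep F)
    (hbp : ∃ a : Fin 3 → k, a ≠ 0 ∧
      ∀ D : MvPolynomial (Fin 3) k, D.IsHomogeneous 2 → contract D F = 0 → eval a D = 0) :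
    ∃ A : Matrix (Fin 3) (Fin 3) k, IsUnit A.det ∧
      (aeval (fun i => ∑ j, C (A i j) * X j) F
          = (X 0 * X 1 ^ 2 + X 1 * X 2 ^ 2 : MvPolynomial (Fin 3) k) ∨
        ∃ g : MvPolynomial (Fin 3) k, g.IsHomogeneous 3 ∧ (∀ s ∈ g.support, s 0 = 0) ∧
          aeval (fun i => ∑ j, C (A i j) * X j) F = X 0 ^ 3 + g) := by
  exact Cub.main F hF hess hbp
end

section
/- For the ternary cubic G = x_0 x_1² + x_1 x_2² + (x_0 + x_1)³, the degree-2 part (G^⊥)_2 of the apolar ideal has empty common zero locus in P(S_1); and for any a_1, a_2 ∈ k with a_1 ≠ 0, the same holds for G' = x_0³ + x_1 x_2 (a_1 x_1 + a_2 x_2) + (x_0 + x_2)³. -/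
open MvPolynomial

theorem contract_add' {k : Type} [Field k] {n : ℕ} (D E F : MvPolynomial (Fin n) k) :
    contract (D + E) F = contract D F + contract E F := by
  unfold contract
  exact Finsupp.sum_add_index' (h := fun (s : Fin n →₀ ℕ) (c : k) => c •
    ((List.finRange n).foldr (fun i G => (fun H => pderiv i H)^[s i] G) F))
    (by simp) (by intros; simp [add_smul])

theorem contract_monomial {k : Type} [Field k] {n : ℕ} (s : Fin n →₀ ℕ) (c : k)
    (F : MvPolynomial (Fin n) k) :
    contract (monomial s c) F = c •
      ((List.finRange n).foldr (fun i G => (fun H => pderiv i H)^[s i] G) F) := by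
  unfold contract
  exact Finsupp.sum_single_index (h := fun (s : Fin n →₀ ℕ) (c : k) => c •
    ((List.finRange n).foldr (fun i G => (fun H => pderiv i H)^[s i] G) F)) (by simp)

theorem contract_two {k : Type} [Field k] (c : k) (i j : Fin 3) (hij : i ≤ j)
    (F : MvPolynomial (Fin 3) k) :
    contract (C c * (X i * X j)) F = C c * pderiv i (pderiv j F) := by
  have h : (C c * (X i * X j) : MvPolynomial (Fin 3) k)
      = monomial (Finsupp.single i 1 + Finsupp.single j 1) c := by
    rw [X, X, monomial_mul, C_mul_monomial]; simp
  rw [h, contract_monomial, smul_eq_C_mul]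
  refine congrArg (fun p => C c * p) ?_
  have hl : List.finRange 3 = [0, 1, 2] := by decide
  rw [hl]
  simp only [List.foldr_cons, List.foldr_nil]
  have key : ∀ (i j : Fin 3) (m : Fin 3), ((Finsupp.single i 1 + Finsupp.single j 1 : Fin 3 →₀ ℕ)) m
      = (if i = m then 1 else 0) + (if j = m then 1 else 0) := by
    intro i j m
    rw [Finsupp.add_apply, Finsupp.single_apply, Finsupp.single_apply]
  rw [key, key, key]
  have hi : i = 0 ∨ i = 1 ∨ i = 2 := by omega
  have hj : j = 0 ∨ j = 1 ∨ j = 2 := by omega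
  rcases hi with rfl | rfl | rfl <;> rcases hj with rfl | rfl | rfl <;> first
    | exact absurd hij (by decide)
    | simp

theorem hom_two {k : Type} [Field k] (c : k) (i j : Fin 3) :
    (C c * (X i * X j) : MvPolynomial (Fin 3) k).IsHomogeneous 2 := by
  have := (isHomogeneous_C (Fin 3) c).mul ((isHomogeneous_X k i).mul (isHomogeneous_X k j))
  simpa using this

/-- The degree-2 part of the apolar ideal of `x₀x₁² + x₁x₂² + (x₀+x₁)³` has empty zero
locus in `ℙ(S₁)`, and likewise for `x₀³ + x₁x₂(a₁x₁ + a₂x₂) + (x₀+x₂)³` whenever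
`a₁ ≠ 0`. -/
theorem stmt_18 (k : Type) [Field k] [IsAlgClosed k] [CharZero k] :
    (∀ a : Fin 3 → k, a ≠ 0 →
      ∃ D : MvPolynomial (Fin 3) k, D.IsHomogeneous 2 ∧
        contract D (X 0 * X 1 ^ 2 + X 1 * X 2 ^ 2 + (X 0 + X 1) ^ 3) = 0 ∧
        eval a D ≠ 0) ∧
    (∀ a₁ a₂ : k, a₁ ≠ 0 → ∀ a : Fin 3 → k, a ≠ 0 →
      ∃ D : MvPolynomial (Fin 3) k, D.IsHomogeneous 2 ∧
        contract D (X 0 ^ 3 + X 1 * X 2 * (C a₁ * X 1 + C a₂ * X 2) + (X 0 + X 2) ^ 3) = 0 ∧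
        eval a D ≠ 0) := by
  have e01 : (pderiv (0 : Fin 3) (X 1 : MvPolynomial (Fin 3) k)) = 0 := pderiv_X_of_ne (by decide)
  have e02 : (pderiv (0 : Fin 3) (X 2 : MvPolynomial (Fin 3) k)) = 0 := pderiv_X_of_ne (by decide)
  have e10 : (pderiv (1 : Fin 3) (X 0 : MvPolynomial (Fin 3) k)) = 0 := pderiv_X_of_ne (by decide)
  have e12 : (pderiv (1 : Fin 3) (X 2 : MvPolynomial (Fin 3) k)) = 0 := pderiv_X_of_ne (by decide)
  have e20 : (pderiv (2 : Fin 3) (X 0 : MvPolynomial (Fin 3) k)) = 0 := pderiv_X_of_ne (by decide)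
  have e21 : (pderiv (2 : Fin 3) (X 1 : MvPolynomial (Fin 3) k)) = 0 := pderiv_X_of_ne (by decide)
  have p2 : ∀ i : Fin 3, pderiv i (2 : MvPolynomial (Fin 3) k) = 0 := fun i => by
    rw [← map_ofNat C 2, pderiv_C]
  have p3 : ∀ i : Fin 3, pderiv i (3 : MvPolynomial (Fin 3) k) = 0 := fun i => by
    rw [← map_ofNat C 3, pderiv_C]
  constructor
  · intro a ha
    by_contra! hcon
    have h1 := hcon (C 1 * (X 0 * X 2)) (hom_two _ _ _) (by
      rw [contract_two _ _ _ (by decide)]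
      simp [pderiv_mul, pderiv_pow, e01, e02, e10, e12, e20, e21, p2, p3])
    have h2 := hcon (C 1 * (X 0 * X 1) + C (-1) * (X 0 * X 0) + C (-1) * (X 2 * X 2))
      (((hom_two _ _ _).add (hom_two _ _ _)).add (hom_two _ _ _)) (by
      simp only [contract_add']
      rw [contract_two _ _ _ (by decide), contract_two _ _ _ (by decide),
        contract_two _ _ _ (by decide)]
      simp [pderiv_mul, pderiv_pow, e01, e02, e10, e12, e20, e21, p2, p3]
      try ring)
    have h3 := hcon (C 3 * (X 1 * X 1) + C (-4) * (X 0 * X 0) + C 3 * (X 2 * X 2))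
      (((hom_two _ _ _).add (hom_two _ _ _)).add (hom_two _ _ _)) (by
      simp only [contract_add']
      rw [contract_two _ _ _ (by decide), contract_two _ _ _ (by decide),
        contract_two _ _ _ (by decide)]
      have c3 : (C 3 : MvPolynomial (Fin 3) k) = 3 := map_ofNat C 3
      have c4 : (C 4 : MvPolynomial (Fin 3) k) = 4 := map_ofNat C 4
      simp [pderiv_mul, pderiv_pow, e01, e02, e10, e12, e20, e21, p2, p3, c3, c4]
      try ring)
    simp at h1 h2 h3
    apply ha
    have h0 : a 0 = 0 := by
      by_contra h0
      have hc : a 2 = 0 := by tauto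
      rw [hc] at h2 h3
      have hb : a 1 = a 0 := mul_left_cancel₀ h0 (by linear_combination h2)
      rw [hb] at h3
      exact h0 (mul_self_eq_zero.1 (by linear_combination -h3))
    rw [h0] at h2 h3
    have hc : a 2 = 0 := mul_self_eq_zero.1 (by linear_combination -h2)
    rw [hc] at h3
    have hb : a 1 = 0 := by simpa using h3
    funext i
    fin_cases i <;> simp [h0, hb, hc]
  · intro a₁ a₂ h a ha
    by_contra! hcon
    have h1 := hcon (C 1 * (X 0 * X 1)) (hom_two _ _ _) (by
      rw [contract_two _ _ _ (by decide)]
      simp [pderiv_mul, pderiv_pow, e01, e02, e10, e12, e20, e21, p2, p3])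
    have h2 := hcon (C a₁ * (X 0 * X 0) + C (-2 * a₁) * (X 0 * X 2) + C 3 * (X 1 * X 1))
      (((hom_two _ _ _).add (hom_two _ _ _)).add (hom_two _ _ _)) (by
      simp only [contract_add']
      rw [contract_two _ _ _ (by decide), contract_two _ _ _ (by decide),
        contract_two _ _ _ (by decide)]
      have c3 : (C 3 : MvPolynomial (Fin 3) k) = 3 := map_ofNat C 3
      have c2 : (C 2 : MvPolynomial (Fin 3) k) = 2 := map_ofNat C 2
      simp [pderiv_mul, pderiv_pow, e01, e02, e10, e12, e20, e21, p2, p3, c3, c2]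
      try ring)
    have h3 := hcon (C (a₁ ^ 2) * (X 2 * X 2) + C (- a₁ ^ 2) * (X 0 * X 2)
        + C (- (a₁ * a₂)) * (X 1 * X 2) + C (a₂ ^ 2) * (X 1 * X 1))
      ((((hom_two _ _ _).add (hom_two _ _ _)).add (hom_two _ _ _)).add (hom_two _ _ _)) (by
      simp only [contract_add']
      rw [contract_two _ _ _ (by decide), contract_two _ _ _ (by decide),
        contract_two _ _ _ (by decide), contract_two _ _ _ (by decide)]
      simp [pderiv_mul, pderiv_pow, e01, e02, e10, e12, e20, e21, p2, p3]
      try ring)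
    simp at h1 h2 h3
    apply ha
    have h0 : a 0 = 0 := by
      by_contra h0
      have hb : a 1 = 0 := by tauto
      rw [hb] at h2 h3
      have hac : a 0 = 2 * a 2 :=
        mul_left_cancel₀ (mul_ne_zero h h0) (by linear_combination h2)
      rw [hac] at h3
      have h4 : a₁ * a 2 = 0 := mul_self_eq_zero.1 (by linear_combination -h3)
      have hc : a 2 = 0 := (mul_eq_zero.1 h4).resolve_left h
      exact h0 (by rw [hac, hc, mul_zero])
    rw [h0] at h2 h3
    have hb : a 1 = 0 := by simpa using h2
    rw [hb] at h3
    have hc : a 2 = 0 := by simpa [h] using h3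
    funext i
    fin_cases i <;> simp [h0, hb, hc]
end
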